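/- Let S be a pointed affine semigroup and ι : ℂ[S] → ℂ[S_∞] the algebra homomorphism induced by S ↪ S_∞. Then there is a ℂ-linear bijection Φ from the ℂ-derivations on ℂ[S] to the ℂ-derivations on ℂ[S_∞], characterized by Φ(D')(χ^∞) = 0 and Φ(D')(χ^a) = (1 − χ^∞)·ι(D'(χ^a)) for all a ∈ S; in particular every ℂ-derivation D on ℂ[S_∞] satisfies D(χ^∞) = 0 and D(χ^a) = (1 − χ^∞)·ι(D'(χ^a)) for a unique ℂ-derivation D' on ℂ[S]. -/

import Mathlib

/-- Derivations of `A` correspond to derivations of `B` when `B` is the product of `A` and a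
quotient of `R`, presented by a section `ι` of `π : B → A` and an idempotent `e` spanning the
second factor. -/
noncomputable def derivationEquivOfIdempotent {R A B : Type*} [CommRing R] [CommRing A]
    [CommRing B] [Algebra R A] [Algebra R B] (ι : A →ₐ[R] B) (π : B →ₐ[R] A) (e : B)
    (hπι : ∀ a, π (ι a) = a) (hπe : π e = 0) (he : e * e = e)
    (hιπ : ∀ x, (1 - e) * ι (π x) = (1 - e) * x) (hspan : ∀ x, ∃ c : R, e * x = c • e) :
    Derivation R A A ≃ₗ[R] Derivation R B B where
  toFun D := Derivation.mk'
    ((LinearMap.mulLeft R (1 - e)).comp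
      (ι.toLinearMap.comp ((D : A →ₗ[R] A).comp π.toLinearMap))) fun x y => by
        simp only [LinearMap.comp_apply, LinearMap.mulLeft_apply, AlgHom.toLinearMap_apply,
          Derivation.coeFn_coe, map_mul, Derivation.leibniz, smul_eq_mul, map_add]
        linear_combination ι (D (π y)) * hιπ x + ι (D (π x)) * hιπ y
  map_add' D E := by
    ext x
    simp [mul_add]
  map_smul' c D := by
    ext x
    simp
  invFun D := Derivation.mk'
    (π.toLinearMap.comp ((D : B →ₗ[R] B).comp ι.toLinearMap)) fun x y => by
      simp [hπι]
  left_inv D := by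
    ext a
    simp [hπι, hπe]
  right_inv D := by
    have hDe : D e = 0 := by
      have h := D.leibniz e e
      rw [he, smul_eq_mul] at h
      linear_combination (1 - 2 * e) * h - 4 * D e * he
    have hD : ∀ y, D ((1 - e) * y) = (1 - e) * D y := fun y => by
      simp [hDe]
    ext x
    obtain ⟨c, hc⟩ := hspan x
    have hex : e * D x = 0 := by
      have h := D.leibniz e x
      rw [hc, D.map_smul, hDe] at h
      simpa using h.symm
    change (1 - e) * ι (π (D (ι (π x)))) = D x
    rw [hιπ, ← hD, hιπ, hD]
    linear_combination -hex

@[simp]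
theorem derivationEquivOfIdempotent_apply {R A B : Type*} [CommRing R] [CommRing A]
    [CommRing B] [Algebra R A] [Algebra R B] (ι : A →ₐ[R] B) (π : B →ₐ[R] A) (e : B)
    (hπι : ∀ a, π (ι a) = a) (hπe : π e = 0) (he : e * e = e)
    (hιπ : ∀ x, (1 - e) * ι (π x) = (1 - e) * x) (hspan : ∀ x, ∃ c : R, e * x = c • e)
    (D : Derivation R A A) (x : B) :
    derivationEquivOfIdempotent ι π e hπι hπe he hιπ hspan D x = (1 - e) * ι (D (π x)) :=
  rfl

namespace AddMonoidAlgebra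

/-- The projection `R[M ∪ {∞}] → R[M]` that kills the absorbing element `∞`. -/
noncomputable def withTopProj (R M : Type*) [CommRing R] [AddCommMonoid M] :
    AddMonoidAlgebra R (WithTop M) →ₐ[R] AddMonoidAlgebra R M :=
  lift R _ (WithTop M)
    { toFun := fun x => WithTop.recTopCoe (C := fun _ => AddMonoidAlgebra R M) 0
        (fun a => single a 1) x.toAdd
      map_one' := rfl
      map_mul' := fun x y => by
        induction x using Multiplicative.rec with | _ x
        induction y using Multiplicative.rec with | _ y
        induction x using WithTop.recTopCoe with
        | top => simp
        | coe a =>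
          induction y using WithTop.recTopCoe with
          | top => simp
          | coe b =>
            change single (a + b) (1 : R) = single a 1 * single b 1
            simp [single_mul_single] }

variable {R M : Type*} [CommRing R] [AddCommMonoid M]

@[simp]
theorem withTopProj_single_top (r : R) :
    withTopProj R M (single (⊤ : WithTop M) r) = 0 :=
  (lift_single _ _ _).trans (smul_zero r)

@[simp]
theorem withTopProj_single_coe (a : M) (r : R) :
    withTopProj R M (single (a : WithTop M) r) = single a r :=
  (lift_single _ _ _).trans (by
    change r • single a (1 : R) = single a r
    simp)

theorem exists_single_top_mul_eq_smul (x : AddMonoidAlgebra R (WithTop M)) :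
    ∃ c : R, single (⊤ : WithTop M) (1 : R) * x = c • single (⊤ : WithTop M) (1 : R) := by
  induction x using AddMonoidAlgebra.induction_linear with
  | zero => exact ⟨0, by simp⟩
  | add x y hx hy =>
    obtain ⟨c, hc⟩ := hx
    obtain ⟨d, hd⟩ := hy
    exact ⟨c + d, by rw [mul_add, hc, hd, add_smul]⟩
  | single a r => exact ⟨r, by simp [single_mul_single]⟩

end AddMonoidAlgebra


/-- There is a ℂ-linear bijection `Φ` from derivations on `ℂ[S]` to
derivations on `ℂ[S_∞]`, characterized by `Φ(D')(χ^∞) = 0` and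
`Φ(D')(χ^a) = (1 − χ^∞)·ι(D'(χ^a))` for all `a ∈ S`. -/
theorem stmt_11 {n : ℕ} (S : AddSubmonoid (Fin n → ℤ)) (hfg : S.FG)
    (hpointed : ∀ a b : S, a + b = 0 → a = 0 ∧ b = 0)
    (ι : AddMonoidAlgebra ℂ S →ₐ[ℂ] AddMonoidAlgebra ℂ (WithTop S))
    (hι : ∀ a : S, ι (AddMonoidAlgebra.single a 1) = AddMonoidAlgebra.single (a : WithTop S) 1) :
    ∃ Φ : Derivation ℂ (AddMonoidAlgebra ℂ S) (AddMonoidAlgebra ℂ S) ≃ₗ[ℂ]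
          Derivation ℂ (AddMonoidAlgebra ℂ (WithTop S)) (AddMonoidAlgebra ℂ (WithTop S)),
      ∀ D' : Derivation ℂ (AddMonoidAlgebra ℂ S) (AddMonoidAlgebra ℂ S),
        Φ D' (AddMonoidAlgebra.single (⊤ : WithTop S) 1) = 0 ∧
        ∀ a : S, Φ D' (AddMonoidAlgebra.single (a : WithTop S) 1) =
          (1 - AddMonoidAlgebra.single (⊤ : WithTop S) 1) *
            ι (D' (AddMonoidAlgebra.single a 1)) := by
  have hπι : ∀ x, AddMonoidAlgebra.withTopProj ℂ S (ι x) = x := by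
    have h : (AddMonoidAlgebra.withTopProj ℂ S).comp ι = AlgHom.id ℂ _ :=
      AddMonoidAlgebra.algHom_ext' (MonoidHom.ext fun a => by
        change AddMonoidAlgebra.withTopProj ℂ S (ι (AddMonoidAlgebra.single a.toAdd 1)) =
          AddMonoidAlgebra.single a.toAdd 1
        rw [hι, AddMonoidAlgebra.withTopProj_single_coe]) (Subsingleton.elim _ _)
    exact DFunLike.congr_fun h
  have he : AddMonoidAlgebra.single (⊤ : WithTop S) (1 : ℂ) *
      AddMonoidAlgebra.single (⊤ : WithTop S) (1 : ℂ) = AddMonoidAlgebra.single ⊤ 1 := by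
    simp [AddMonoidAlgebra.single_mul_single]
  have hιπ : ∀ x, (1 - AddMonoidAlgebra.single (⊤ : WithTop S) (1 : ℂ)) *
      ι (AddMonoidAlgebra.withTopProj ℂ S x) =
        (1 - AddMonoidAlgebra.single (⊤ : WithTop S) (1 : ℂ)) * x := by
    intro x
    induction x using AddMonoidAlgebra.induction_linear with
    | zero => simp
    | add x y hx hy => rw [map_add, map_add, mul_add, mul_add, hx, hy]
    | single a r =>
      have hr : ∀ {N : Type} (b : N), AddMonoidAlgebra.single b r =
          r • AddMonoidAlgebra.single b (1 : ℂ) := fun b => by simp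
      rw [hr, map_smul, map_smul, mul_smul_comm, mul_smul_comm]
      induction a using WithTop.recTopCoe with
      | top =>
        rw [AddMonoidAlgebra.withTopProj_single_top, map_zero, mul_zero, sub_mul, he, one_mul,
          sub_self]
      | coe a => rw [AddMonoidAlgebra.withTopProj_single_coe, hι]
  refine ⟨derivationEquivOfIdempotent ι (AddMonoidAlgebra.withTopProj ℂ S)
    (AddMonoidAlgebra.single ⊤ 1) hπι (AddMonoidAlgebra.withTopProj_single_top 1) he hιπ
    AddMonoidAlgebra.exists_single_top_mul_eq_smul, fun D' => ⟨?_, fun a => ?_⟩⟩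
  · rw [derivationEquivOfIdempotent_apply, AddMonoidAlgebra.withTopProj_single_top, map_zero,
      map_zero, mul_zero]
  · rw [derivationEquivOfIdempotent_apply, AddMonoidAlgebra.withTopProj_single_coe]
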